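/- arXiv:2305.17278 — 2 statements merged into one kernel-verified Lean document; each statement's English description precedes it below -/
import Mathlib

section
/- Let c_m(c_1) ∈ Q[c_1] be defined by c_0 = 1, c_1 the indeterminate, and for m ≥ 2 by (m² − 1)·c_m = Σ_{p=0}^{m−2} (p+2)(m−2(p+1))·c_{p+1}·c_{m−p−1} + 4·Σ_{p=0}^{m−2} Σ_{p₁=0}^{p} c_{m−p−2}·c_{p₁}·c_{p−p₁}. Then for all k ≥ 0: deg(c_{3k}) ≤ k, deg(c_{3k+2}) ≤ k, and deg(c_{3k+1}) ≤ k+1. -/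
open Polynomial Finset in
/-- The recurrence defining the Taylor coefficients `c_m(c_1)` of the vanishing
meromorphic solution of the degenerate third Painlevé equation at `a = ± i/2`:
`c_0 = 1`, `c_1` is the indeterminate, and for `m ≥ 2`,
`(m² − 1) c_m = Σ_{p=0}^{m−2} (p+2)(m−2(p+1)) c_{p+1} c_{m−p−1}
  + 4 Σ_{p=0}^{m−2} Σ_{p₁=0}^{p} c_{m−p−2} c_{p₁} c_{p−p₁}`. -/
def PIIIRec (c : ℕ → Polynomial ℚ) : Prop :=
  c 0 = 1 ∧ c 1 = X ∧
    ∀ m : ℕ, 2 ≤ m →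
      C ((m : ℚ) ^ 2 - 1) * c m =
        (∑ p ∈ Finset.range (m - 1),
            C (((p : ℚ) + 2) * ((m : ℚ) - 2 * ((p : ℚ) + 1))) * (c (p + 1) * c (m - p - 1)))
          + 4 * ∑ p ∈ Finset.range (m - 1), ∑ p₁ ∈ Finset.range (p + 1),
              c (m - p - 2) * c p₁ * c (p - p₁)

open Polynomial in
/-- Polynomials supported in the degrees `d` for which `n - 3 * d` is even and nonnegative. -/
def weightSubmodule (n : ℕ) : Submodule ℚ ℚ[X] where
  carrier := {f | ∀ d, f.coeff d ≠ 0 → ∃ e, 3 * d + 2 * e = n}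
  zero_mem' := by simp
  add_mem' := by
    intro f g hf hg d hd
    by_cases h : f.coeff d = 0
    · exact hg d (by simpa [h] using hd)
    · exact hf d h
  smul_mem' := by
    intro a f hf d hd
    exact hf d (by simp at hd; exact hd.2)

open Polynomial in
theorem mul_mem_weightSubmodule {a b n : ℕ} {f g : ℚ[X]} (hf : f ∈ weightSubmodule a)
    (hg : g ∈ weightSubmodule b) (h : a + b = n) : f * g ∈ weightSubmodule n := by
  intro d hd
  rw [coeff_mul] at hd
  obtain ⟨x, hx, hne⟩ := Finset.exists_ne_zero_of_sum_ne_zero hd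
  obtain ⟨e₁, h₁⟩ := hf x.1 (left_ne_zero_of_mul hne)
  obtain ⟨e₂, h₂⟩ := hg x.2 (right_ne_zero_of_mul hne)
  rw [Finset.HasAntidiagonal.mem_antidiagonal] at hx
  exact ⟨e₁ + e₂, by omega⟩

open Polynomial in
theorem natCast_mul_mem_weightSubmodule {n : ℕ} {f : ℚ[X]} (hf : f ∈ weightSubmodule n) (a : ℕ) :
    (a : ℚ[X]) * f ∈ weightSubmodule n := by
  rw [← nsmul_eq_mul]
  exact Submodule.smul_of_tower_mem _ a hf

open Polynomial in
theorem mem_weightSubmodule_of_X_mul {n : ℕ} {f : ℚ[X]} (hf : X * f ∈ weightSubmodule (n + 3)) :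
    f ∈ weightSubmodule n := by
  intro d hd
  obtain ⟨e, he⟩ := hf (d + 1) (by rwa [coeff_X_mul])
  exact ⟨e, by omega⟩

open PowerSeries in
/-- The Euler derivation `x d/dx` on formal power series. -/
noncomputable def eulerDerivation (R : Type*) [CommRing R] : Derivation R R⟦X⟧ R⟦X⟧ :=
  (X : R⟦X⟧) • derivative R

open PowerSeries in
theorem coeff_eulerDerivation {R : Type*} [CommRing R] (f : R⟦X⟧) (n : ℕ) :
    coeff n (eulerDerivation R f) = n * coeff n f := by
  cases n with
  | zero => simp [eulerDerivation]
  | succ n => simp [eulerDerivation, coeff_succ_X_mul, coeff_derivative, mul_comm]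

open PowerSeries in
theorem eulerDerivation_X {R : Type*} [CommRing R] : eulerDerivation R (X : R⟦X⟧) = X := by
  simp [eulerDerivation]

open PowerSeries in
theorem eulerDerivation_natCast {R : Type*} [CommRing R] (a : ℕ) :
    eulerDerivation R (a : R⟦X⟧) = 0 := by
  rw [← nsmul_one, map_nsmul, Derivation.map_one_eq_zero, smul_zero]

open PowerSeries in
/-- A power series whose coefficients up to order `N` lie in the weight spaces shifted by `s`. -/
def HasWeightUpTo (N s : ℕ) (F : (Polynomial ℚ)⟦X⟧) : Prop :=
  ∀ i ≤ N, coeff i F ∈ weightSubmodule (i + s)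

namespace HasWeightUpTo

open PowerSeries

variable {N s t : ℕ} {F G : (Polynomial ℚ)⟦X⟧}

theorem add (hF : HasWeightUpTo N s F) (hG : HasWeightUpTo N s G) :
    HasWeightUpTo N s (F + G) := fun i hi ↦ by
  rw [map_add]
  exact add_mem (hF i hi) (hG i hi)

theorem sub (hF : HasWeightUpTo N s F) (hG : HasWeightUpTo N s G) :
    HasWeightUpTo N s (F - G) := fun i hi ↦ by
  rw [map_sub]
  exact sub_mem (hF i hi) (hG i hi)

theorem mul (hF : HasWeightUpTo N s F) (hG : HasWeightUpTo N t G) :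
    HasWeightUpTo N (s + t) (F * G) := fun i hi ↦ by
  rw [coeff_mul]
  refine sum_mem fun x hx ↦ ?_
  rw [Finset.HasAntidiagonal.mem_antidiagonal] at hx
  exact mul_mem_weightSubmodule (hF x.1 (by omega)) (hG x.2 (by omega)) (by omega)

theorem nsmul (hF : HasWeightUpTo N s F) (a : ℕ) : HasWeightUpTo N s (a • F) := fun i hi ↦ by
  rw [map_nsmul]
  exact Submodule.smul_of_tower_mem _ a (hF i hi)

theorem eulerDerivation (hF : HasWeightUpTo N s F) :
    HasWeightUpTo N s (eulerDerivation _ F) := fun i hi ↦ by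
  rw [coeff_eulerDerivation]
  exact natCast_mul_mem_weightSubmodule (hF i hi) i

end HasWeightUpTo

open PowerSeries in
/-- The differential equation satisfied by the generating function. -/
theorem PIIIRec.ode {c : ℕ → Polynomial ℚ} (hc : PIIIRec c) :
    PowerSeries.mk c * eulerDerivation _ (eulerDerivation _ (PowerSeries.mk c))
      - eulerDerivation _ (PowerSeries.mk c) ^ 2
      = PowerSeries.mk c - 1 + 4 * (X ^ 2 * PowerSeries.mk c ^ 3) := by
  obtain ⟨h0, h1, hrec⟩ := hc
  ext1 m
  have h4 : (4 : (Polynomial ℚ)⟦X⟧) = C 4 := (map_ofNat C 4).symm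
  rw [map_sub, map_add, map_sub, h4, coeff_C_mul, sq (eulerDerivation _ _), coeff_mul, coeff_mul,
    ← Finset.sum_sub_distrib]
  simp only [coeff_eulerDerivation, coeff_mk]
  match m with
  | 0 => simp [h0]
  | 1 => simp [h0, h1, Finset.Nat.antidiagonal_succ, coeff_X_pow_mul', coeff_one]
  | n + 2 =>
    have hr := hrec (n + 2) (by omega)
    have hcub : coeff (n + 2) (X ^ 2 * PowerSeries.mk c ^ 3) =
        ∑ p ∈ Finset.range (n + 2 - 1), ∑ p₁ ∈ Finset.range (p + 1),
          c (n + 2 - p - 2) * c p₁ * c (p - p₁) := by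
      rw [coeff_X_pow_mul, pow_succ, sq, coeff_mul,
        Finset.Nat.sum_antidiagonal_eq_sum_range_succ_mk]
      refine Finset.sum_congr rfl fun p hp ↦ ?_
      rw [coeff_mul, Finset.Nat.sum_antidiagonal_eq_sum_range_succ_mk, Finset.sum_mul]
      refine Finset.sum_congr rfl fun q hq ↦ ?_
      simp only [coeff_mk]
      rw [show n + 2 - p - 2 = n - p by omega]
      ring
    rw [hcub]
    set Q := ∑ p ∈ Finset.range (n + 2 - 1), ∑ p₁ ∈ Finset.range (p + 1),
          c (n + 2 - p - 2) * c p₁ * c (p - p₁)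
    have hbil : ∑ x ∈ Finset.HasAntidiagonal.antidiagonal (n + 2),
          ((x.1 : Polynomial ℚ) + 1) * (x.2 - x.1) * (c x.1 * c x.2) =
        (∑ p ∈ Finset.range (n + 2 - 1),
          Polynomial.C (((p : ℚ) + 2) * (((n + 2 : ℕ) : ℚ) - 2 * ((p : ℚ) + 1))) *
            (c (p + 1) * c (n + 2 - p - 1))) - ((n : Polynomial ℚ) + 2) ^ 2 * c (n + 2) := by
      rw [Finset.Nat.sum_antidiagonal_eq_sum_range_succ_mk, Finset.sum_range_succ,
        Finset.sum_range_succ']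
      have : ∀ p ∈ Finset.range (n + 1),
          (((p + 1 : ℕ) : Polynomial ℚ) + 1) * (((n + 2 - (p + 1) : ℕ) : Polynomial ℚ)
            - ((p + 1 : ℕ) : Polynomial ℚ)) * (c (p + 1) * c (n + 2 - (p + 1))) =
          Polynomial.C (((p : ℚ) + 2) * (((n + 2 : ℕ) : ℚ) - 2 * ((p : ℚ) + 1))) *
            (c (p + 1) * c (n + 2 - p - 1)) := by
        intro p hp
        rw [Finset.mem_range] at hp
        rw [Nat.cast_sub (by omega), Nat.sub_sub]
        simp [map_ofNat Polynomial.C 2]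
        left
        ring
      rw [Finset.sum_congr rfl this]
      simp [h0]
      ring
    have hswap := Finset.Nat.sum_antidiagonal_swap (n := n + 2)
      (f := fun x ↦ ((x.1 : Polynomial ℚ) + 1) * (x.2 - x.1) * (c x.1 * c x.2))
    have hanti := Finset.Nat.sum_antidiagonal_swap (n := n + 2)
      (f := fun x ↦ ((x.1 : Polynomial ℚ) - x.2) * (c x.1 * c x.2))
    have hanti0 : ∑ x ∈ Finset.HasAntidiagonal.antidiagonal (n + 2),
        ((x.1 : Polynomial ℚ) - x.2) * (c x.1 * c x.2) = 0 := by
      rw [← self_eq_neg, ← Finset.sum_neg_distrib, ← hanti]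
      refine Finset.sum_congr rfl fun x _ ↦ ?_
      simp only [Prod.fst_swap, Prod.snd_swap]
      ring
    have hsum : ∑ x ∈ Finset.HasAntidiagonal.antidiagonal (n + 2), (c x.1 * (x.2 * (x.2 * c x.2))
          - x.1 * c x.1 * (x.2 * c x.2)) =
        -∑ x ∈ Finset.HasAntidiagonal.antidiagonal (n + 2),
          ((x.1 : Polynomial ℚ) + 1) * (x.2 - x.1) * (c x.1 * c x.2) := by
      rw [← hswap, ← add_zero (-_), ← hanti0, ← Finset.sum_neg_distrib, ← Finset.sum_add_distrib]
      refine Finset.sum_congr rfl fun x _ ↦ ?_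
      simp only [Prod.fst_swap, Prod.snd_swap]
      ring
    rw [hsum, hbil]
    simp [coeff_one, map_ofNat Polynomial.C 2] at hr ⊢
    linear_combination hr

open PowerSeries in
/-- A consequence of the differential equation in which `c 0` no longer multiplies the
top-order coefficient. -/
theorem PIIIRec.derived_ode {c : ℕ → Polynomial ℚ} (hc : PIIIRec c)
    (U U₁ U₂ U₃ U₄ : (Polynomial ℚ)⟦X⟧) (hU : PowerSeries.mk c = U)
    (h₁ : eulerDerivation _ U = U₁) (h₂ : eulerDerivation _ U₁ = U₂)
    (h₃ : eulerDerivation _ U₂ = U₃) (h₄ : eulerDerivation _ U₃ = U₄) :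
    U₁ * U₄ - U₂ * U₃ = X ^ 2 * (16 • (U * U * U₁) + 48 • (U * U₁ * U₁) + 24 • (U₁ * U₁ * U₁)
      - 8 • (U * U * U₂)) := by
  have e₀ := hc.ode
  have hU0 : U ≠ 0 := by
    intro h
    have := congrArg (coeff 0) (hU.trans h)
    simp [hc.1] at this
  rw [hU, h₁, h₂] at e₀
  have h4 : eulerDerivation (Polynomial ℚ) (4 : (Polynomial ℚ)⟦X⟧) = 0 := by
    exact_mod_cast eulerDerivation_natCast 4
  have e₁ := congrArg (eulerDerivation _) e₀
  simp only [map_add, map_sub, Derivation.leibniz, Derivation.leibniz_pow, smul_eq_mul, h₁, h₂, h₃,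
    eulerDerivation_X, Derivation.map_one_eq_zero, h4, nsmul_eq_mul] at e₁
  have e₂ := congrArg (eulerDerivation _) e₁
  simp only [map_add, map_sub, Derivation.leibniz, Derivation.leibniz_pow, smul_eq_mul, h₁, h₂, h₃,
    h₄, eulerDerivation_X, h4, nsmul_eq_mul, eulerDerivation_natCast, map_zero] at e₂
  apply mul_left_cancel₀ hU0
  simp only [nsmul_eq_mul]
  push_cast at e₁ e₂ ⊢
  linear_combination U₁ * e₂ - U₂ * e₁

open PowerSeries in
theorem PIIIRec.mem_weightSubmodule {c : ℕ → Polynomial ℚ} (hc : PIIIRec c) (m : ℕ) :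
    c m ∈ weightSubmodule (m + 2) := by
  induction m using Nat.strong_induction_on with
  | _ m ih =>
  match m with
  | 0 =>
    rw [hc.1]
    intro d hd
    rw [Polynomial.coeff_one] at hd
    exact ⟨1, by simp at hd; omega⟩
  | 1 =>
    rw [hc.2.1]
    intro d hd
    rw [Polynomial.coeff_X] at hd
    exact ⟨0, by simp at hd; omega⟩
  | n + 2 =>
    have hode := hc.derived_ode _ _ _ _ _ rfl rfl rfl rfl rfl
    have hU : HasWeightUpTo (n + 1) 2 (PowerSeries.mk c) := fun i hi ↦ by
      rw [coeff_mk]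
      exact ih i (by omega)
    have hU₁ := hU.eulerDerivation
    have hU₂ := hU₁.eulerDerivation
    have hcub := (((((hU.mul hU).mul hU₁).nsmul 16).add (((hU.mul hU₁).mul hU₁).nsmul 48)).add
      (((hU₁.mul hU₁).mul hU₁).nsmul 24)).sub (((hU.mul hU).mul hU₂).nsmul 8) (n + 1) le_rfl
    have hcoeff := congrArg (coeff (n + 1 + 2)) hode
    rw [coeff_X_pow_mul] at hcoeff
    rw [← hcoeff, map_sub, coeff_mul, coeff_mul, ← Finset.sum_sub_distrib,
      Finset.Nat.sum_antidiagonal_eq_sum_range_succ_mk, Finset.sum_range_succ,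
      Finset.sum_range_succ, Finset.sum_range_succ', Finset.sum_range_succ'] at hcub
    simp only [coeff_eulerDerivation, coeff_mk] at hcub
    have hmid : ∑ k ∈ Finset.range n,
        (((k + 1 + 1 : ℕ) : Polynomial ℚ) * c (k + 1 + 1) *
          (((n + 1 + 2 - (k + 1 + 1) : ℕ) : Polynomial ℚ) *
            (((n + 1 + 2 - (k + 1 + 1) : ℕ) : Polynomial ℚ) *
            (((n + 1 + 2 - (k + 1 + 1) : ℕ) : Polynomial ℚ) *
            (((n + 1 + 2 - (k + 1 + 1) : ℕ) : Polynomial ℚ) * c (n + 1 + 2 - (k + 1 + 1)))))) -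
        ((k + 1 + 1 : ℕ) : Polynomial ℚ) * (((k + 1 + 1 : ℕ) : Polynomial ℚ) * c (k + 1 + 1)) *
          (((n + 1 + 2 - (k + 1 + 1) : ℕ) : Polynomial ℚ) *
            (((n + 1 + 2 - (k + 1 + 1) : ℕ) : Polynomial ℚ) *
            (((n + 1 + 2 - (k + 1 + 1) : ℕ) : Polynomial ℚ) * c (n + 1 + 2 - (k + 1 + 1)))))) ∈
        weightSubmodule (n + 1 + (2 + 2 + 2)) := by
      refine sum_mem fun k hk ↦ ?_
      rw [Finset.mem_range] at hk
      have hl := ih (k + 1 + 1) (by omega)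
      have hr := ih (n + 1 + 2 - (k + 1 + 1)) (by omega)
      refine sub_mem (mul_mem_weightSubmodule (a := k + 1 + 1 + 2)
        (b := n + 1 + 2 - (k + 1 + 1) + 2) ?_ ?_ (by omega))
        (mul_mem_weightSubmodule (a := k + 1 + 1 + 2)
        (b := n + 1 + 2 - (k + 1 + 1) + 2) ?_ ?_ (by omega)) <;>
      · repeat' first | assumption | apply natCast_mul_mem_weightSubmodule
    have htop := sub_mem hcub hmid
    have hs : n + 1 + 2 - (n + 1 + 1) = 1 := by omega
    have hpos : ((n : ℚ) + 2) * (n + 1) ^ 2 * (n + 3) ≠ 0 := by positivity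
    rw [← Submodule.smul_mem_iff _ hpos]
    apply mem_weightSubmodule_of_X_mul
    convert htop using 1
    simp [hs, hc.2.1, Polynomial.smul_eq_C_mul, map_ofNat Polynomial.C 2, map_ofNat Polynomial.C 3]
    ring

theorem cm_degree_bound (c : ℕ → Polynomial ℚ) (hc : PIIIRec c) (k : ℕ) :
    (c (3 * k)).natDegree ≤ k ∧ (c (3 * k + 2)).natDegree ≤ k ∧
      (c (3 * k + 1)).natDegree ≤ k + 1 := by
  refine ⟨?_, ?_, ?_⟩ <;>
  · rw [Polynomial.natDegree_le_iff_coeff_eq_zero]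
    intro d hd
    by_contra h
    obtain ⟨e, he⟩ := hc.mem_weightSubmodule _ d h
    omega
end

section
/- Define c_m ∈ Q[c_1] by c_0 = 1, c_1 the indeterminate, and (m² − 1)c_m = Σ_{p=0}^{m−2}(p+2)(m−2(p+1))c_{p+1}c_{m−p−1} + 4Σ_{p=0}^{m−2}Σ_{p₁=0}^{p} c_{m−p−2}c_{p₁}c_{p−p₁} for m ≥ 2. Then for every m ≥ 2, every coefficient of c_m is a rational number whose numerator (in lowest terms) is even; equivalently, c_m is divisible by 2 in the sense that all coefficients have positive 2-adic valuation. -/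
namespace DegeneratePIII

open Polynomial

/-! ### Divisibility by powers of two of rational polynomials -/

/-- All coefficients of `p` have 2-adic valuation at least `e`. -/
def TwoPowDvd (e : ℕ) (p : ℚ[X]) : Prop :=
  ∃ d : ℤ, Odd d ∧ ∃ q : ℤ[X], (d : ℚ[X]) * p = 2 ^ e * q.map (Int.castRingHom ℚ)

namespace TwoPowDvd

variable {e e' : ℕ} {p p' : ℚ[X]}

lemma zero (e : ℕ) : TwoPowDvd e 0 := ⟨1, odd_one, 0, by simp⟩

lemma one : TwoPowDvd 0 1 := ⟨1, odd_one, 1, by simp⟩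

lemma X : TwoPowDvd 0 (Polynomial.X : ℚ[X]) := ⟨1, odd_one, Polynomial.X, by simp⟩

lemma add (h : TwoPowDvd e p) (h' : TwoPowDvd e p') : TwoPowDvd e (p + p') := by
  obtain ⟨d, hd, q, hq⟩ := h
  obtain ⟨d', hd', q', hq'⟩ := h'
  refine ⟨d * d', hd.mul hd', d' * q + d * q', ?_⟩
  simp only [Polynomial.map_add, Polynomial.map_mul, Polynomial.map_intCast, Int.cast_mul]
  linear_combination (d' : ℚ[X]) * hq + (d : ℚ[X]) * hq'

lemma neg (h : TwoPowDvd e p) : TwoPowDvd e (-p) := by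
  obtain ⟨d, hd, q, hq⟩ := h
  refine ⟨d, hd, -q, ?_⟩
  simp only [Polynomial.map_neg]
  linear_combination -hq

lemma sub (h : TwoPowDvd e p) (h' : TwoPowDvd e p') : TwoPowDvd e (p - p') := by
  rw [sub_eq_add_neg]
  exact h.add h'.neg

lemma mul (h : TwoPowDvd e p) (h' : TwoPowDvd e' p') : TwoPowDvd (e + e') (p * p') := by
  obtain ⟨d, hd, q, hq⟩ := h
  obtain ⟨d', hd', q', hq'⟩ := h'
  refine ⟨d * d', hd.mul hd', q * q', ?_⟩
  simp only [Polynomial.map_mul, Int.cast_mul]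
  calc (d : ℚ[X]) * d' * (p * p') = (d * p) * (d' * p') := by ring
    _ = _ := by rw [hq, hq']; ring

lemma mono (h : TwoPowDvd e p) (he : e' ≤ e) : TwoPowDvd e' p := by
  obtain ⟨d, hd, q, hq⟩ := h
  obtain ⟨r, rfl⟩ := Nat.exists_eq_add_of_le he
  refine ⟨d, hd, 2 ^ r * q, ?_⟩
  simp only [Polynomial.map_mul, Polynomial.map_pow, Polynomial.map_ofNat]
  rw [hq]
  ring

lemma sum {ι : Type*} {s : Finset ι} {f : ι → ℚ[X]} (h : ∀ i ∈ s, TwoPowDvd e (f i)) :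
    TwoPowDvd e (∑ i ∈ s, f i) :=
  Finset.sum_induction f (TwoPowDvd e) (fun _ _ => add) (zero e) h

lemma two_mul (h : TwoPowDvd e p) : TwoPowDvd (e + 1) (2 * p) := by
  obtain ⟨d, hd, q, hq⟩ := h
  exact ⟨d, hd, q, by linear_combination 2 * hq⟩

lemma of_odd_mul {a : ℤ} (ha : Odd a) (h : TwoPowDvd e ((a : ℚ[X]) * p)) : TwoPowDvd e p := by
  obtain ⟨d, hd, q, hq⟩ := h
  refine ⟨d * a, hd.mul ha, q, ?_⟩
  rw [← hq]
  push_cast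
  ring

lemma of_two_pow_mul {r : ℕ} (h : TwoPowDvd (e + r) (2 ^ r * p)) : TwoPowDvd e p := by
  obtain ⟨d, hd, q, hq⟩ := h
  refine ⟨d, hd, q, ?_⟩
  have h2 : (2 ^ r : ℚ[X]) ≠ 0 := pow_ne_zero _ two_ne_zero
  apply mul_left_cancel₀ h2
  linear_combination hq

lemma of_natCast_mul {k : ℕ} (hk : k ≠ 0)
    (h : TwoPowDvd (e + padicValNat 2 k) ((k : ℚ[X]) * p)) : TwoPowDvd e p := by
  obtain ⟨r, m, hm, rfl⟩ := Nat.exists_eq_two_pow_mul_odd hk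
  have hv : padicValNat 2 (2 ^ r * m) = r := by
    rw [padicValNat.mul (by positivity) (by rintro rfl; simp at hm), padicValNat.prime_pow,
      padicValNat.eq_zero_of_not_dvd (by simpa [← even_iff_two_dvd] using hm), add_zero]
  rw [hv] at h
  refine of_odd_mul (a := m) (by exact_mod_cast hm) (of_two_pow_mul (r := r) ?_)
  convert h using 1
  push_cast
  ring

lemma even_num_coeff (h : TwoPowDvd 1 p) (n : ℕ) : Even (p.coeff n).num := by
  obtain ⟨d, hd, q, hq⟩ := h
  have h1 : (d : ℚ) * p.coeff n = 2 * (q.coeff n : ℚ) := by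
    have h2 := congrArg (fun r => Polynomial.coeff r n) hq
    simp only [pow_one] at h2
    rw [← Polynomial.C_eq_intCast, Polynomial.coeff_C_mul, ← Polynomial.C_ofNat,
      Polynomial.coeff_C_mul, Polynomial.coeff_map] at h2
    simpa using h2
  have h3 : d * (p.coeff n).num = 2 * (q.coeff n * (p.coeff n).den) := by
    have h4 := Rat.mul_den_eq_num (p.coeff n)
    have : (d : ℚ) * (p.coeff n).num = 2 * (q.coeff n * (p.coeff n).den) := by
      rw [← h4]
      linear_combination ((p.coeff n).den : ℚ) * h1
    exact_mod_cast this
  have h5 : Even (d * (p.coeff n).num) := h3 ▸ even_two_mul _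
  exact (Int.even_mul.mp h5).resolve_left (Int.not_even_iff_odd.mpr hd)

end TwoPowDvd

/-! ### The exponent `k - ν₂(k!)`, that is, the binary digit sum of `k` -/

/-- The 2-adic valuation of `2 ^ k / k!`. -/
def wt (k : ℕ) : ℕ := k - padicValNat 2 k.factorial

lemma wt_add_padicValNat_factorial (k : ℕ) : wt k + padicValNat 2 k.factorial = k := by
  have := sub_one_mul_padicValNat_factorial (p := 2) k
  unfold wt
  lia

lemma wt_add_le (a b : ℕ) : wt (a + b) ≤ wt a + wt b := by
  have h : padicValNat 2 (a.factorial * b.factorial) ≤ padicValNat 2 (a + b).factorial :=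
    (padicValNat_dvd_iff_le (Nat.factorial_ne_zero _)).mp
      (pow_padicValNat_dvd.trans (Nat.factorial_mul_factorial_dvd_factorial_add a b))
  rw [padicValNat.mul (Nat.factorial_ne_zero _) (Nat.factorial_ne_zero _)] at h
  have ha := wt_add_padicValNat_factorial a
  have hb := wt_add_padicValNat_factorial b
  have hab := wt_add_padicValNat_factorial (a + b)
  lia

lemma wt_succ (k : ℕ) : wt (k + 1) + padicValNat 2 (k + 1) = wt k + 1 := by
  have h := wt_add_padicValNat_factorial (k + 1)
  have h' := wt_add_padicValNat_factorial k
  rw [Nat.factorial_succ, padicValNat.mul (by lia) (Nat.factorial_ne_zero _)] at h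
  lia

lemma wt_zero : wt 0 = 0 := by simp [wt]

lemma wt_one : wt 1 = 1 := by simp [wt]

lemma wt_two : wt 2 = 1 := by simp [wt]

lemma wt_pos {k : ℕ} (hk : k ≠ 0) : 0 < wt k := by
  have h := sub_one_mul_padicValNat_factorial_lt_of_ne_zero 2 hk
  have := wt_add_padicValNat_factorial k
  lia

lemma wt_succ_le (k : ℕ) : wt (k + 1) ≤ wt k + 1 := by
  simpa [wt_one] using wt_add_le k 1

lemma wt_add_two_le (k : ℕ) : wt (k + 2) ≤ wt k + 1 := by
  simpa [wt_two] using wt_add_le k 2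

/-! ### The Euler operator on power series -/

/-- The Euler operator `x d/dx`. -/
noncomputable def euler (f : PowerSeries ℚ[X]) : PowerSeries ℚ[X] :=
  PowerSeries.X * PowerSeries.derivative ℚ[X] f

lemma coeff_four_mul (g : PowerSeries ℚ[X]) (m : ℕ) :
    PowerSeries.coeff m (4 * g) = 4 * PowerSeries.coeff m g := by
  rw [← map_ofNat (PowerSeries.C (R := ℚ[X])) 4, PowerSeries.coeff_C_mul]

lemma coeff_natCast_mul (a : ℕ) (g : PowerSeries ℚ[X]) (m : ℕ) :
    PowerSeries.coeff m ((a : PowerSeries ℚ[X]) * g) = (a : ℚ[X]) * PowerSeries.coeff m g := by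
  rw [← map_natCast (PowerSeries.C (R := ℚ[X])) a, PowerSeries.coeff_C_mul]

lemma coeff_euler (f : PowerSeries ℚ[X]) (m : ℕ) :
    PowerSeries.coeff m (euler f) = (m : ℚ[X]) * PowerSeries.coeff m f := by
  cases m with
  | zero => simp [euler]
  | succ m =>
    rw [euler, PowerSeries.coeff_succ_X_mul, PowerSeries.coeff_derivative]
    push_cast
    ring

lemma euler_add (f g : PowerSeries ℚ[X]) : euler (f + g) = euler f + euler g := by
  simp [euler, mul_add]

lemma euler_sub (f g : PowerSeries ℚ[X]) : euler (f - g) = euler f - euler g := by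
  simp [euler, mul_sub]

lemma euler_mul (f g : PowerSeries ℚ[X]) : euler (f * g) = euler f * g + f * euler g := by
  simp only [euler, Derivation.leibniz, smul_eq_mul]
  ring

lemma euler_natCast (n : ℕ) : euler (n : PowerSeries ℚ[X]) = 0 := by
  simp [euler]

lemma euler_one : euler 1 = 0 := by
  simp [euler]

lemma euler_X : euler PowerSeries.X = PowerSeries.X := by
  simp [euler]

/-! ### The Bäcklund chain -/

/-- Coefficients of the power series solution `h` of `(θ + κ) h = 1 - 4 x² F h²`. -/
noncomputable def riccatiCoeff (κ : ℕ) (F : PowerSeries ℚ[X]) : ℕ → ℚ[X]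
  | m => C ((m + κ : ℚ)⁻¹) * PowerSeries.coeff m (1 - 4 * (PowerSeries.X ^ 2 * (F *
      (PowerSeries.mk fun i => if _h : i < m then riccatiCoeff κ F i else 0) ^ 2)))

/-- The power series solution `h` of `(θ + κ) h = 1 - 4 x² F h²`. -/
noncomputable def riccati (κ : ℕ) (F : PowerSeries ℚ[X]) : PowerSeries ℚ[X] :=
  PowerSeries.mk (riccatiCoeff κ F)

lemma coeff_X_sq_mul_mul_sq_congr {F g g' : PowerSeries ℚ[X]} {m : ℕ}
    (h : ∀ i < m, PowerSeries.coeff i g = PowerSeries.coeff i g') :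
    PowerSeries.coeff m (PowerSeries.X ^ 2 * (F * g ^ 2)) =
      PowerSeries.coeff m (PowerSeries.X ^ 2 * (F * g' ^ 2)) := by
  have hd : (PowerSeries.X : PowerSeries ℚ[X]) ^ m ∣ g - g' := by
    rw [PowerSeries.X_pow_dvd_iff]
    intro i hi
    rw [map_sub, h i hi, sub_self]
  rw [← sub_eq_zero, ← map_sub]
  obtain ⟨r, hr⟩ := hd
  have : PowerSeries.X ^ 2 * (F * g ^ 2) - PowerSeries.X ^ 2 * (F * g' ^ 2) =
      PowerSeries.X ^ (m + 1) * (PowerSeries.X * (F * (g + g') * r)) := by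
    linear_combination PowerSeries.X ^ 2 * F * (g + g') * hr
  rw [this]
  exact PowerSeries.X_pow_dvd_iff.mp (dvd_mul_right _ _) m m.lt_succ_self

lemma riccati_eq {κ : ℕ} (hκ : 0 < κ) (F : PowerSeries ℚ[X]) :
    euler (riccati κ F) + (κ : PowerSeries ℚ[X]) * riccati κ F =
      1 - 4 * (PowerSeries.X ^ 2 * (F * riccati κ F ^ 2)) := by
  ext1 m
  have hc : (m + κ : ℚ[X]) * C ((m + κ : ℚ)⁻¹) = 1 := by
    have : (m + κ : ℚ[X]) = C (m + κ : ℚ) := by simp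
    rw [this, ← C_mul, mul_inv_cancel₀ (by positivity), C_1]
  have hm : PowerSeries.coeff m (riccati κ F) = C ((m + κ : ℚ)⁻¹) *
      PowerSeries.coeff m (1 - 4 * (PowerSeries.X ^ 2 * (F * riccati κ F ^ 2))) := by
    have hcongr := coeff_X_sq_mul_mul_sq_congr (F := F) (m := m)
      (g := PowerSeries.mk fun i => if _h : i < m then riccatiCoeff κ F i else 0)
      (g' := riccati κ F) (fun i hi => by simp [riccati, hi])
    rw [map_sub, coeff_four_mul, ← hcongr, ← coeff_four_mul, ← map_sub, ← riccatiCoeff,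
      riccati, PowerSeries.coeff_mk]
  rw [map_add, coeff_euler, coeff_natCast_mul,
    ← add_mul, hm, ← mul_assoc, hc, one_mul]

/-- The second order equation `f θ²f - (θf)² = κ f - 1 + 4 x² f³`, normalized at the origin. -/
structure IsSol (κ : ℕ) (f : PowerSeries ℚ[X]) : Prop where
  eqn : f * euler (euler f) - euler f ^ 2 =
    (κ : PowerSeries ℚ[X]) * f - 1 + 4 * (PowerSeries.X ^ 2 * f ^ 3)
  coeff_zero : (κ : ℚ[X]) * PowerSeries.coeff 0 f = 1

lemma eq_zero_of_mul_euler_eq {κ : ℕ} {f E : PowerSeries ℚ[X]}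
    (hf : (κ : ℚ[X]) * PowerSeries.coeff 0 f = 1) (hE0 : PowerSeries.coeff 0 E = 0)
    (hE : f * euler E = E * (E + (κ : PowerSeries ℚ[X]) * f - 2)) : E = 0 := by
  ext1 m
  rw [map_zero]
  induction m using Nat.strong_induction_on with
  | _ m ih =>
    have hd : PowerSeries.X ^ m ∣ E := PowerSeries.X_pow_dvd_iff.mpr ih
    obtain ⟨r, rfl⟩ := hd
    have hr (g : PowerSeries ℚ[X]) : PowerSeries.coeff m (PowerSeries.X ^ m * g) =
        PowerSeries.coeff 0 g := by
      simpa using PowerSeries.coeff_X_pow_mul g m 0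
    have hX : euler (PowerSeries.X ^ m) = (m : PowerSeries ℚ[X]) * PowerSeries.X ^ m := by
      ext1 i
      rw [coeff_euler, coeff_natCast_mul,
        PowerSeries.coeff_X_pow]
      split_ifs with h
      · rw [h]
      · simp
    have key : f * ((m : PowerSeries ℚ[X]) * r + euler r) =
        r * (PowerSeries.X ^ m * r + (κ : PowerSeries ℚ[X]) * f - 2) := by
      have hne : (PowerSeries.X ^ m : PowerSeries ℚ[X]) ≠ 0 :=
        pow_ne_zero _ PowerSeries.X_ne_zero
      apply mul_left_cancel₀ hne
      rw [euler_mul, hX] at hE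
      linear_combination hE
    have key0 := congrArg PowerSeries.constantCoeff key
    rw [hr]
    have he : PowerSeries.constantCoeff (euler r) = 0 := by simp [euler]
    simp only [PowerSeries.coeff_zero_eq_constantCoeff, map_mul, map_add, map_sub, map_natCast,
      map_ofNat, he] at key0 hE0 hf ⊢
    rw [hE0] at key0
    have hmul : (m + κ : ℚ[X]) * PowerSeries.constantCoeff r = 0 := by
      linear_combination (κ : ℚ[X]) * key0 - (m - κ) * PowerSeries.constantCoeff r * hf
    have hκ : κ ≠ 0 := by
      rintro rfl
      simp at hf
    refine (mul_eq_zero.mp hmul).resolve_left ?_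
    exact_mod_cast (by lia : m + κ ≠ 0)

lemma IsSol.euler_eq {κ : ℕ} {f : PowerSeries ℚ[X]} (hf : IsSol κ f) :
    euler f = (κ : PowerSeries ℚ[X]) * f - 1 +
      4 * (PowerSeries.X ^ 2 * (f ^ 2 * riccati (κ + 2) f)) := by
  have hh := riccati_eq (Nat.succ_pos (κ + 1)) f
  change euler (riccati (κ + 2) f) + ((κ + 2 : ℕ) : PowerSeries ℚ[X]) * riccati (κ + 2) f =
    1 - 4 * (PowerSeries.X ^ 2 * (f * riccati (κ + 2) f ^ 2)) at hh
  generalize riccati (κ + 2) f = h at *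
  have h1 := hf.eqn
  rw [← sub_eq_zero]
  refine eq_zero_of_mul_euler_eq hf.coeff_zero ?_ ?_
  · have := hf.coeff_zero
    simp only [PowerSeries.coeff_zero_eq_constantCoeff] at this
    simp [euler, this]
  · have h4 : euler 4 = 0 := by simpa using euler_natCast 4
    simp only [euler_sub, euler_add, euler_mul, euler_natCast, euler_one, h4, pow_two, euler_X]
    push_cast at hh
    linear_combination h1 - 4 * PowerSeries.X ^ 2 * f ^ 3 * hh

lemma IsSol.isSol_riccati {κ : ℕ} {f : PowerSeries ℚ[X]} (hf : IsSol κ f) :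
    IsSol (κ + 2) (riccati (κ + 2) f) := by
  have hh := riccati_eq (Nat.succ_pos (κ + 1)) f
  change euler (riccati (κ + 2) f) +
    ((κ + 2 : ℕ) : PowerSeries ℚ[X]) * riccati (κ + 2) f =
    1 - 4 * (PowerSeries.X ^ 2 * (f * riccati (κ + 2) f ^ 2)) at hh
  have hfe := hf.euler_eq
  generalize riccati (κ + 2) f = h at *
  constructor
  · have h4 : euler 4 = 0 := by simpa using euler_natCast 4
    have h2 := congrArg euler hh
    simp only [euler_sub, euler_add, euler_mul, euler_natCast, euler_one, h4, pow_two,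
      euler_X] at h2
    push_cast at *
    linear_combination h * h2 - 4 * PowerSeries.X ^ 2 * h ^ 3 * hfe -
      (1 + euler h + 4 * PowerSeries.X ^ 2 * f * h ^ 2) * hh
  · have := congrArg PowerSeries.constantCoeff hh
    have h2 : PowerSeries.constantCoeff (2 : PowerSeries ℚ[X]) = 2 := map_ofNat _ 2
    simpa [euler, h2] using this

/-- The Bäcklund chain of solutions with parameters `1, 3, 5, …` that starts at `f`. -/
noncomputable def chain (f : PowerSeries ℚ[X]) : ℕ → PowerSeries ℚ[X]
  | 0 => f
  | n + 1 => riccati (2 * n + 3) (chain f n)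

variable {f : PowerSeries ℚ[X]}

lemma isSol_chain (hf : IsSol 1 f) (n : ℕ) : IsSol (2 * n + 1) (chain f n) := by
  induction n with
  | zero => exact hf
  | succ n ih => exact ih.isSol_riccati

lemma euler_chain (hf : IsSol 1 f) (n : ℕ) :
    euler (chain f n) = ((2 * n + 1 : ℕ) : PowerSeries ℚ[X]) * chain f n - 1 +
      4 * (PowerSeries.X ^ 2 * (chain f n * chain f (n + 1) * chain f n)) := by
  rw [(isSol_chain hf n).euler_eq, chain]
  ring

lemma euler_chain_succ (f : PowerSeries ℚ[X]) (n : ℕ) :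
    euler (chain f (n + 1)) = 1 - ((2 * n + 3 : ℕ) : PowerSeries ℚ[X]) * chain f (n + 1) -
      4 * (PowerSeries.X ^ 2 * (chain f n * chain f (n + 1) * chain f (n + 1))) := by
  have h := riccati_eq (Nat.succ_pos (2 * n + 2)) (chain f n)
  change euler (chain f (n + 1)) + ((2 * n + 3 : ℕ) : PowerSeries ℚ[X]) * chain f (n + 1) =
    1 - 4 * (PowerSeries.X ^ 2 * (chain f n * chain f (n + 1) ^ 2)) at h
  linear_combination h

lemma euler_chain_mul_chain_succ (hf : IsSol 1 f) (n : ℕ) :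
    euler (chain f n * chain f (n + 1)) + 2 * (chain f n * chain f (n + 1)) =
      chain f n - chain f (n + 1) := by
  rw [euler_mul, euler_chain hf, euler_chain_succ]
  push_cast
  ring

lemma coeff_add_two_X_sq_mul (g : PowerSeries ℚ[X]) (m : ℕ) :
    PowerSeries.coeff (m + 2) (PowerSeries.X ^ 2 * g) = PowerSeries.coeff m g :=
  PowerSeries.coeff_X_pow_mul g 2 m

lemma coeff_chain (hf : IsSol 1 f) (n m : ℕ) :
    ((m + 2 - (2 * n + 1) : ℤ) : ℚ[X]) * PowerSeries.coeff (m + 2) (chain f n) =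
      4 * PowerSeries.coeff m (chain f n * chain f (n + 1) * chain f n) := by
  have h := congrArg (PowerSeries.coeff (m + 2)) (euler_chain hf n)
  simp only [coeff_euler, map_add, map_sub, coeff_four_mul, coeff_natCast_mul,
    coeff_add_two_X_sq_mul, PowerSeries.coeff_one] at h
  simp only [Nat.add_eq_zero_iff, OfNat.ofNat_ne_zero, and_false, if_false] at h
  push_cast at *
  linear_combination h

lemma coeff_chain_succ (f : PowerSeries ℚ[X]) (n m : ℕ) :
    ((m + 2 + (2 * n + 3) : ℤ) : ℚ[X]) * PowerSeries.coeff (m + 2) (chain f (n + 1)) =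
      -4 * PowerSeries.coeff m (chain f n * chain f (n + 1) * chain f (n + 1)) := by
  have h := congrArg (PowerSeries.coeff (m + 2)) (euler_chain_succ f n)
  simp only [coeff_euler, map_sub, coeff_four_mul, coeff_natCast_mul,
    coeff_add_two_X_sq_mul, PowerSeries.coeff_one] at h
  simp only [Nat.add_eq_zero_iff, OfNat.ofNat_ne_zero, and_false, if_false] at h
  push_cast at *
  linear_combination h

lemma coeff_one_chain_succ (f : PowerSeries ℚ[X]) (n : ℕ) :
    PowerSeries.coeff 1 (chain f (n + 1)) = 0 := by
  have h := congrArg (PowerSeries.coeff 1) (euler_chain_succ f n)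
  have h1 (g : PowerSeries ℚ[X]) : PowerSeries.coeff 1 (PowerSeries.X ^ 2 * g) = 0 :=
    PowerSeries.X_pow_dvd_iff.mp (dvd_mul_right _ _) 1 one_lt_two
  simp only [coeff_euler, map_sub, coeff_four_mul, coeff_natCast_mul, h1,
    PowerSeries.coeff_one, one_ne_zero, if_false] at h
  have h2 : ((2 * n + 4 : ℕ) : ℚ[X]) * PowerSeries.coeff 1 (chain f (n + 1)) = 0 := by
    push_cast at *
    linear_combination h
  refine (mul_eq_zero.mp h2).resolve_left ?_
  exact_mod_cast (by lia : 2 * n + 4 ≠ 0)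

lemma coeff_chain_mul_chain_succ (hf : IsSol 1 f) (n m : ℕ) :
    ((m + 2 : ℤ) : ℚ[X]) * PowerSeries.coeff m (chain f n * chain f (n + 1)) =
      PowerSeries.coeff m (chain f n) - PowerSeries.coeff m (chain f (n + 1)) := by
  have h := congrArg (PowerSeries.coeff m) (euler_chain_mul_chain_succ hf n)
  rw [map_add, coeff_euler, map_sub, ← Nat.cast_ofNat (R := PowerSeries ℚ[X]) (n := 2),
    coeff_natCast_mul] at h
  push_cast at *
  linear_combination h

/-! ### Dyadic estimates along the chain -/

/-- The dyadic estimates for the coefficients of index below `N` along the chain. -/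
def ChainBound (f : PowerSeries ℚ[X]) (N : ℕ) : Prop :=
  (∀ n, ∀ m < N, TwoPowDvd (wt (m / 2)) (PowerSeries.coeff m (chain f n))) ∧
    ∀ n k, 2 * k + 1 < N →
      TwoPowDvd (wt (k - 1) + 1) (PowerSeries.coeff (2 * k + 1) (chain f (n + 1)))

lemma ChainBound.coeff_mul {N : ℕ} (h : ChainBound f N) (hf : IsSol 1 f) {m : ℕ} (hm : m < N)
    (n : ℕ) :
    TwoPowDvd (wt (m / 2)) (PowerSeries.coeff m (chain f n * chain f (n + 1))) := by
  rcases Nat.even_or_odd' m with ⟨k, rfl | rfl⟩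
  · rw [PowerSeries.coeff_mul]
    refine TwoPowDvd.sum fun ⟨p, q⟩ hpq => ?_
    rw [Finset.HasAntidiagonal.mem_antidiagonal] at hpq
    dsimp only at hpq ⊢
    rcases Nat.even_or_odd' q with ⟨b, rfl | rfl⟩
    · refine ((h.1 n p (by lia)).mul (h.1 (n + 1) (2 * b) (by lia))).mono ?_
      have := wt_add_le (p / 2) (2 * b / 2)
      rwa [show p / 2 + 2 * b / 2 = 2 * k / 2 by lia] at this
    · refine ((h.1 n p (by lia)).mul (h.2 n b (by lia))).mono ?_
      rcases b with _ | b
      · have := wt_succ_le (p / 2)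
        rw [show p / 2 + 1 = 2 * k / 2 by lia] at this
        simpa [wt_zero] using this
      · have := wt_add_two_le (p / 2 + b)
        have h' := wt_add_le (p / 2) b
        rw [show p / 2 + b + 2 = 2 * k / 2 by lia] at this
        simp only [Nat.add_sub_cancel]
        lia
  · refine TwoPowDvd.of_odd_mul (a := ((2 * k + 1 : ℕ) + 2 : ℤ)) ⟨k + 1, by push_cast; ring⟩ ?_
    rw [coeff_chain_mul_chain_succ hf]
    exact (h.1 n _ hm).sub (h.1 (n + 1) _ hm)

lemma ChainBound.coeff_mul_mul_odd {N : ℕ} (h : ChainBound f N) (hf : IsSol 1 f) {k : ℕ}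
    (hk : 2 * k + 1 < N) (n n' : ℕ) :
    TwoPowDvd (wt k)
      (PowerSeries.coeff (2 * k + 1) (chain f n * chain f (n + 1) * chain f n')) := by
  rw [PowerSeries.coeff_mul]
  refine TwoPowDvd.sum fun ⟨p, q⟩ hpq => ?_
  rw [Finset.HasAntidiagonal.mem_antidiagonal] at hpq
  dsimp only at hpq ⊢
  refine ((h.coeff_mul hf (by lia : p < N) n).mul (h.1 n' q (by lia))).mono ?_
  have := wt_add_le (p / 2) (q / 2)
  rwa [show p / 2 + q / 2 = k by lia] at this

lemma ChainBound.two_mul_coeff_mul_mul {N : ℕ} (h : ChainBound f N) (hf : IsSol 1 f) {m : ℕ}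
    (hm : m < N) (n n' : ℕ) :
    TwoPowDvd (wt (m / 2))
      (2 * PowerSeries.coeff m (chain f n * chain f (n + 1) * chain f n')) := by
  rw [PowerSeries.coeff_mul, Finset.mul_sum]
  refine TwoPowDvd.sum fun ⟨p, q⟩ hpq => ?_
  rw [Finset.HasAntidiagonal.mem_antidiagonal] at hpq
  dsimp only at hpq ⊢
  refine ((h.coeff_mul hf (by lia : p < N) n).mul (h.1 n' q (by lia))).two_mul.mono ?_
  have h1 := wt_add_le (p / 2) (q / 2)
  have h2 := wt_succ_le (p / 2 + q / 2)
  rcases (by lia : p / 2 + q / 2 = m / 2 ∨ p / 2 + q / 2 + 1 = m / 2) with h3 | h3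
  · rw [h3] at h1
    lia
  · rw [h3] at h2
    lia

lemma ChainBound.coeff_succ_odd {N : ℕ} (h : ChainBound f N) (hf : IsSol 1 f) {k : ℕ}
    (hk : 2 * k + 1 ≤ N) (n : ℕ) :
    TwoPowDvd (wt (k - 1) + 1) (PowerSeries.coeff (2 * k + 1) (chain f (n + 1))) := by
  rcases k with _ | k
  · rw [mul_zero, zero_add, coeff_one_chain_succ]
    exact TwoPowDvd.zero _
  rw [Nat.add_sub_cancel, show 2 * (k + 1) + 1 = 2 * k + 1 + 2 by ring]
  rcases Nat.even_or_odd (k + n) with hkn | hkn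
  · refine TwoPowDvd.of_odd_mul (a := (k + n + 3 : ℤ)) ?_ (TwoPowDvd.of_two_pow_mul (r := 1) ?_)
    · exact_mod_cast hkn.add_odd (by decide : Odd 3)
    · have := (h.coeff_mul_mul_odd hf (by lia : 2 * k + 1 < N) n (n + 1)).two_mul.two_mul.neg
      convert this using 1
      have h' := coeff_chain_succ f n (2 * k + 1)
      push_cast at *
      linear_combination h'
  · refine TwoPowDvd.of_odd_mul (a := (k - n : ℤ)) ?_ (TwoPowDvd.of_two_pow_mul (r := 1) ?_)
    · have : Odd (k + n : ℤ) := by exact_mod_cast hkn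
      exact Int.odd_sub.mpr (Int.odd_add.mp this)
    · have := (h.coeff_mul_mul_odd hf (by lia : 2 * k + 1 < N) (n + 1) (n + 1)).two_mul.two_mul
      convert this using 1
      have h' := coeff_chain hf (n + 1) (2 * k + 1)
      push_cast at *
      linear_combination h'

lemma ChainBound.coeff_zero_odd {N : ℕ} (h : ChainBound f N) (hf : IsSol 1 f)
    (h1 : PowerSeries.coeff 1 f = X) {k : ℕ} (hk : 2 * k + 1 ≤ N) :
    TwoPowDvd (wt k) (PowerSeries.coeff (2 * k + 1) f) := by
  rcases k with _ | k
  · rw [mul_zero, zero_add, h1, wt_zero]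
    exact TwoPowDvd.X
  refine TwoPowDvd.of_natCast_mul k.succ_ne_zero ?_
  rw [Nat.succ_eq_add_one, wt_succ]
  refine TwoPowDvd.of_two_pow_mul (r := 1) ?_
  convert (h.coeff_mul_mul_odd hf (by lia : 2 * k + 1 < N) 0 0).two_mul.two_mul using 1
  have h' := coeff_chain hf 0 (2 * k + 1)
  simp only [chain] at h' ⊢
  push_cast at *
  linear_combination h'

lemma ChainBound.coeff_even {N : ℕ} (h : ChainBound f N) (hf : IsSol 1 f) {k : ℕ}
    (hk : 2 * k ≤ N) (n : ℕ) :
    TwoPowDvd (wt k) (PowerSeries.coeff (2 * k) (chain f n)) := by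
  rcases k with _ | k
  · refine TwoPowDvd.of_odd_mul (a := ((2 * n + 1 : ℕ) : ℤ)) ⟨n, by push_cast; ring⟩ ?_
    rw [mul_zero, Int.cast_natCast, (isSol_chain hf n).coeff_zero, wt_zero]
    exact TwoPowDvd.one
  · refine TwoPowDvd.of_odd_mul (a := ((2 * k : ℕ) + 2 - (2 * n + 1) : ℤ))
      ⟨k - n, by push_cast; ring⟩ ?_
    rw [mul_add_one, coeff_chain hf]
    have := (h.two_mul_coeff_mul_mul hf (by lia : 2 * k < N) n n).two_mul
    rw [← mul_assoc, Nat.mul_div_cancel_left k two_pos] at this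
    convert this.mono (wt_succ_le k) using 2
    norm_num

lemma chainBound (hf : IsSol 1 f) (h1 : PowerSeries.coeff 1 f = X) (N : ℕ) :
    ChainBound f N := by
  induction N with
  | zero => exact ⟨fun _ _ h => absurd h (Nat.not_lt_zero _),
      fun _ _ h => absurd h (Nat.not_lt_zero _)⟩
  | succ N ih =>
    refine ⟨fun n m hm => ?_, fun n k hk => ih.coeff_succ_odd hf (by lia) n⟩
    rcases Nat.even_or_odd' m with ⟨k, rfl | rfl⟩
    · rw [Nat.mul_div_cancel_left k two_pos]
      exact ih.coeff_even hf (by lia) n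
    · rw [show (2 * k + 1) / 2 = k by lia]
      rcases n with _ | n
      · exact ih.coeff_zero_odd hf h1 (by lia)
      · refine (ih.coeff_succ_odd hf (by lia) n).mono ?_
        rcases k with _ | k
        · simp [wt_zero]
        · exact wt_succ_le k

/-! ### The recurrence as a differential equation -/

lemma sum_antisymm_eq_zero (c : ℕ → ℚ[X]) (m : ℕ) :
    ∑ p ∈ Finset.range (m + 1),
      ((m : ℚ[X]) - 2 * p) * (c (p + 1) * c (m + 1 - p)) = 0 := by
  set S := ∑ p ∈ Finset.range (m + 1), ((m : ℚ[X]) - 2 * p) * (c (p + 1) * c (m + 1 - p)) with hS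
  have h : S = -S := by
    conv_lhs => rw [hS, ← Finset.sum_range_reflect]
    rw [hS, ← Finset.sum_neg_distrib]
    refine Finset.sum_congr rfl fun p hp => ?_
    rw [Finset.mem_range] at hp
    obtain ⟨q, rfl⟩ := Nat.exists_eq_add_of_le (Nat.le_of_lt_succ hp)
    rw [show p + q + 1 - 1 - p = q by lia, show p + q + 1 - q = p + 1 by lia,
      show p + q + 1 - p = q + 1 by lia]
    push_cast
    ring
  exact self_eq_neg.mp h

lemma _root_.PIIIRec.isSol {c : ℕ → ℚ[X]} (hc : PIIIRec c) :
    IsSol 1 (PowerSeries.mk c) := by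
  obtain ⟨h0, h1, hrec⟩ := hc
  constructor
  swap
  · simp [h0]
  ext1 m
  rcases m with _ | _ | m
  · simp [euler, h0]
  · have hX (g : PowerSeries ℚ[X]) : PowerSeries.coeff 1 (PowerSeries.X ^ 2 * g) = 0 :=
      PowerSeries.X_pow_dvd_iff.mp (dvd_mul_right _ _) 1 one_lt_two
    rw [zero_add, map_sub, map_add, map_sub, coeff_four_mul, hX, pow_two]
    simp only [PowerSeries.coeff_mul, coeff_euler, PowerSeries.coeff_mk,
      Finset.Nat.antidiagonal_succ, Finset.Nat.antidiagonal_zero]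
    simp [h0, h1, PowerSeries.coeff_one]
  · have hr := hrec (m + 2) (by lia)
    have ha := sum_antisymm_eq_zero c m
    simp only [map_sub, map_add, coeff_four_mul, coeff_add_two_X_sq_mul, coeff_natCast_mul]
    rw [pow_two, PowerSeries.coeff_mul, PowerSeries.coeff_mul, ← Finset.sum_sub_distrib,
      pow_succ (PowerSeries.mk c), pow_two, PowerSeries.coeff_mul m]
    simp only [coeff_euler, PowerSeries.coeff_mk, PowerSeries.coeff_mul, PowerSeries.coeff_one,
      Finset.Nat.sum_antidiagonal_eq_sum_range_succ_mk]
    rw [Finset.sum_range_succ, Finset.sum_range_succ']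
    have hmid : ∑ p ∈ Finset.range (m + 1),
        (c (p + 1) * (((m + 1 + 1 - (p + 1) : ℕ) : ℚ[X]) *
            (((m + 1 + 1 - (p + 1) : ℕ) : ℚ[X]) * c (m + 1 + 1 - (p + 1)))) -
          ((p + 1 : ℕ) : ℚ[X]) * c (p + 1) *
            (((m + 1 + 1 - (p + 1) : ℕ) : ℚ[X]) * c (m + 1 + 1 - (p + 1)))) =
        (m + 3) * ∑ p ∈ Finset.range (m + 1),
          ((m : ℚ[X]) - 2 * p) * (c (p + 1) * c (m + 1 - p)) -
        ∑ p ∈ Finset.range (m + 2 - 1),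
          C (((p : ℚ) + 2) * (((m + 2 : ℕ) : ℚ) - 2 * ((p : ℚ) + 1))) *
          (c (p + 1) * c (m + 2 - p - 1)) := by
      rw [show m + 2 - 1 = m + 1 by lia, Finset.mul_sum, ← Finset.sum_sub_distrib]
      refine Finset.sum_congr rfl fun p hp => ?_
      rw [Finset.mem_range] at hp
      obtain ⟨q, rfl⟩ := Nat.exists_eq_add_of_le (Nat.le_of_lt_succ hp)
      rw [show p + q + 1 + 1 - (p + 1) = q + 1 by lia, show p + q + 1 - p = q + 1 by lia,
        show p + q + 2 - p - 1 = q + 1 by lia]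
      simp only [C_mul, C_add, C_sub, map_natCast, map_ofNat, map_one]
      push_cast
      ring
    have hcubic : ∑ p ∈ Finset.range (m + 2 - 1), ∑ p₁ ∈ Finset.range (p + 1),
        c (m + 2 - p - 2) * c p₁ * c (p - p₁) =
        ∑ p ∈ Finset.range m.succ, (∑ p₁ ∈ Finset.range p.succ, c p₁ * c (p - p₁)) * c (m - p) := by
      refine Finset.sum_congr rfl fun p _ => ?_
      rw [Finset.sum_mul]
      refine Finset.sum_congr rfl fun p₁ _ => ?_
      rw [show m + 2 - p - 2 = m - p by lia]
      ring
    rw [hmid, ha, ← hcubic]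
    simp only [C_sub, C_pow, map_natCast, map_one] at hr
    simp only [Nat.sub_self, Nat.sub_zero, Nat.add_eq_zero_iff, one_ne_zero, and_false, if_false,
      h0]
    push_cast at *
    linear_combination hr

end DegeneratePIII

theorem cm_coeff_num_even (c : ℕ → Polynomial ℚ) (hc : PIIIRec c) (m : ℕ) (hm : 2 ≤ m) :
    ∀ n : ℕ, Even ((c m).coeff n).num := by
  have h := (DegeneratePIII.chainBound hc.isSol (by simpa using hc.2.1) (m + 1)).1 0 m
    m.lt_succ_self
  rw [DegeneratePIII.chain, PowerSeries.coeff_mk] at h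
  exact (h.mono (DegeneratePIII.wt_pos (by lia))).even_num_coeff
end
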